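/- For any positive integer n, there is no pair H, K of modularly homogeneous real Hadamard matrices of order 4n such that every entry of H Kᵀ is congruent to 2 modulo 4. -/

import Mathlib

/-- A real Hadamard matrix of order `m` (with integer entries):
entries in `{1, -1}` and `H * Hᵀ = m • I`. -/
def IsHadamard (m : ℕ) (H : Matrix (Fin m) (Fin m) ℤ) : Prop :=
  (∀ i j, H i j = 1 ∨ H i j = -1) ∧
  H * H.transpose = (m : ℤ) • (1 : Matrix (Fin m) (Fin m) ℤ)

/-- The all-ones matrix of order `m`. -/
def allOnes (m : ℕ) : Matrix (Fin m) (Fin m) ℤ := Matrix.of fun _ _ => 1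

/-- `H` and `K` are modularly homogeneous if every entry of `HJ + JKᵀ` is
divisible by 4, `J` the all-ones matrix. -/
def ModHomogeneous (m : ℕ) (H K : Matrix (Fin m) (Fin m) ℤ) : Prop :=
  ∀ i j, (4 : ℤ) ∣ (H * allOnes m + allOnes m * K.transpose) i j

theorem no_modHomogeneous_pair_with_two_mod_four (n : ℕ) (hn : 0 < n) :
    ¬ ∃ H K : Matrix (Fin (4 * n)) (Fin (4 * n)) ℤ,
      IsHadamard (4 * n) H ∧ IsHadamard (4 * n) K ∧
      ModHomogeneous (4 * n) H K ∧
      (∀ i j, (H * K.transpose) i j % 4 = 2) := by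
  rintro ⟨H, K, hH, hK, hM, h2⟩
  have i0 : Fin (4 * n) := ⟨0, by omega⟩
  have h := h2 i0 i0
  have hm := hM i0 i0
  simp only [Matrix.add_apply, Matrix.mul_apply, Matrix.transpose_apply, allOnes,
    Matrix.of_apply, mul_one, one_mul] at h hm
  have hd : (4 : ℤ) ∣ ∑ k, (H i0 k - 1) * (K i0 k - 1) := by
    refine Finset.dvd_sum fun k _ => ?_
    rcases hH.1 i0 k with a | a <;> rcases hK.1 i0 k with b | b <;> rw [a, b] <;> norm_num
  have he : ∑ k, (H i0 k - 1) * (K i0 k - 1)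
      = ∑ k, H i0 k * K i0 k - (∑ k, H i0 k + ∑ k, K i0 k) + 4 * (n : ℤ) := by
    have hc : (4 * (n : ℤ)) = ∑ _k : Fin (4 * n), (1 : ℤ) := by simp
    rw [hc, ← Finset.sum_add_distrib, ← Finset.sum_sub_distrib, ← Finset.sum_add_distrib]
    exact Finset.sum_congr rfl fun k _ => by ring
  rw [he] at hd
  omega
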